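/- Let A be a 7-tuple with an identity 1, let a ∈ A be one-sided invertible with y ⇀ a = e₀ = a ↼ z for some y, z ∈ A and bar-unit e₀, and define Ψ_a(x) = (y ↼ x) ⇀ a. For a bar-unit e define the left addition x ⊎⃗ₑ y = x + e ⇀ y, the right addition x ⊎⃖ₑ y = x ↼ e + y, and the Hu-Liu product x •ₑ y = x ↼ y + x ⇀ y − (x ↼ e) ⇀ y. Then for every bar-unit e ∈ ℏ×(A) and all x₁, x₂ ∈ A: Ψ_a(x₁ ⊎⃗ₑ x₂) = Ψ_a(x₁) ⊎⃗_{Ψ_a(e)} Ψ_a(x₂), Ψ_a(x₁ ⊎⃖ₑ x₂) = Ψ_a(x₁) ⊎⃖_{Ψ_a(e)} Ψ_a(x₂), and Ψ_a(x₁ •ₑ x₂) = Ψ_a(x₁) •_{Ψ_a(e)} Ψ_a(x₂), where Ψ_a(e) is again a bar-unit. -/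

import Mathlib

/-- A 7-tuple: an abelian group with three binary operations `sharp` (♯),
`lp` (left product ⇀) and `rp` (right product ↼), each associative and
bi-distributive over `+`, satisfying the Hu-Liu triassociative law. -/
structure SevenTuple (A : Type*) [AddCommGroup A] where
  sharp : A → A → A
  lp : A → A → A
  rp : A → A → A
  sharp_assoc : ∀ x y z : A, sharp (sharp x y) z = sharp x (sharp y z)
  lp_assoc : ∀ x y z : A, lp (lp x y) z = lp x (lp y z)
  rp_assoc : ∀ x y z : A, rp (rp x y) z = rp x (rp y z)
  sharp_add_left : ∀ x y z : A, sharp (x + y) z = sharp x z + sharp y z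
  sharp_add_right : ∀ x y z : A, sharp x (y + z) = sharp x y + sharp x z
  lp_add_left : ∀ x y z : A, lp (x + y) z = lp x z + lp y z
  lp_add_right : ∀ x y z : A, lp x (y + z) = lp x y + lp x z
  rp_add_left : ∀ x y z : A, rp (x + y) z = rp x z + rp y z
  rp_add_right : ∀ x y z : A, rp x (y + z) = rp x y + rp x z
  tri1 : ∀ x y z : A, sharp (lp x y) z = sharp x (rp y z)
  tri2 : ∀ x y z : A, lp (sharp x y) z = sharp x (lp y z)
  tri3 : ∀ x y z : A, rp x (sharp y z) = sharp (rp x y) z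
  tri4 : ∀ x y z : A, lp x (sharp y z) = lp (lp x y) z
  tri5 : ∀ x y z : A, rp (sharp x y) z = rp (rp x y) z

variable {A : Type*} [AddCommGroup A]

/-- A bar-unit: `e ↼ x = x = x ⇀ e` for all `x`. -/
def SevenTuple.IsBarUnit (T : SevenTuple A) (e : A) : Prop :=
  ∀ x : A, T.rp e x = x ∧ T.lp x e = x

/-- An identity: `x ♯ 1 = x = 1 ♯ x` and `x ⇀ 1 = x = 1 ↼ x` for all `x`. -/
def SevenTuple.IsIdentity (T : SevenTuple A) (one : A) : Prop :=
  ∀ x : A, T.sharp x one = x ∧ T.sharp one x = x ∧ T.lp x one = x ∧ T.rp one x = x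

/-- The halo ℏ×(A): the set of bar-units. -/
def SevenTuple.halo (T : SevenTuple A) : Set A := {e | T.IsBarUnit e}

/-- The additive halo ℏ⁺(A) relative to a bar-unit `e`: `{α | e ⇀ α = 0}`. -/
def SevenTuple.addHalo (T : SevenTuple A) (e : A) : Set A := {α | T.lp e α = 0}

/-- The Hu-Liu product induced by `e`: `x • y = x ↼ y + x ⇀ y − (x ↼ e) ⇀ y`. -/
def SevenTuple.bullet (T : SevenTuple A) (e x y : A) : A :=
  T.rp x y + T.lp x y - T.lp (T.rp x e) y

/-- The angle bracket `⟨x, y⟩ = x ⇀ y − y ↼ x`. -/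
def SevenTuple.angle (T : SevenTuple A) (x y : A) : A := T.lp x y - T.rp y x

/-- The square bracket `[x, y] = x ♯ y − y ♯ x`. -/
def SevenTuple.sq (T : SevenTuple A) (x y : A) : A := T.sharp x y - T.sharp y x

namespace SevenTuple

variable {T : SevenTuple A} {one : A}

theorem IsIdentity.lp_eq (h : T.IsIdentity one) (x y : A) :
    T.lp x y = T.sharp x (T.lp one y) := by
  rw [← T.tri2, (h x).1]

/-- Both products are governed by the same map `x ↦ 1 ⇀ x`. -/
theorem IsIdentity.rp_eq (h : T.IsIdentity one) (x y : A) :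
    T.rp x y = T.sharp (T.lp one x) y := by
  rw [T.tri1, (h _).2.1]

theorem IsIdentity.lp_one_sharp (h : T.IsIdentity one) (x y : A) :
    T.lp one (T.sharp x y) = T.sharp (T.lp one x) (T.lp one y) := by
  rw [T.tri4, h.lp_eq]

theorem IsIdentity.lp_one_lp_one (h : T.IsIdentity one) (x : A) :
    T.lp one (T.lp one x) = T.lp one x := by
  rw [← T.lp_assoc, (h one).2.2.1]

theorem IsIdentity.isBarUnit_iff (h : T.IsIdentity one) (e : A) :
    T.IsBarUnit e ↔ T.lp one e = one := by
  refine ⟨fun he => (he one).2, fun he x => ?_⟩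
  rw [h.rp_eq, h.lp_eq x, he]
  exact ⟨(h x).2.1, (h x).1⟩

/-- The map `x ↦ (y ↼ x) ⇀ a`. -/
def diconj (T : SevenTuple A) (y a x : A) : A := T.lp (T.rp y x) a

theorem diconj_add (T : SevenTuple A) (y a u v : A) :
    T.diconj y a (u + v) = T.diconj y a u + T.diconj y a v := by
  simp only [diconj, T.rp_add_right, T.lp_add_left]

theorem diconj_sub (T : SevenTuple A) (y a u v : A) :
    T.diconj y a (u - v) = T.diconj y a u - T.diconj y a v := by
  rw [eq_sub_iff_add_eq, ← diconj_add, sub_add_cancel]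

theorem IsIdentity.diconj_eq (h : T.IsIdentity one) (y a x : A) :
    T.diconj y a x = T.sharp (T.lp one y) (T.sharp x (T.lp one a)) := by
  rw [diconj, h.lp_eq, h.rp_eq, T.sharp_assoc]

theorem IsIdentity.lp_one_diconj (h : T.IsIdentity one) (y a x : A) :
    T.lp one (T.diconj y a x) = T.diconj y a (T.lp one x) := by
  simp only [h.diconj_eq, h.lp_one_sharp, h.lp_one_lp_one]

theorem IsIdentity.diconj_sharp (h : T.IsIdentity one) {y a : A}
    (hay : T.sharp (T.lp one a) (T.lp one y) = one) (u v : A) :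
    T.diconj y a (T.sharp u v) = T.sharp (T.diconj y a u) (T.diconj y a v) := by
  simp only [h.diconj_eq, T.sharp_assoc]
  rw [← T.sharp_assoc (T.lp one a) (T.lp one y), hay, (h _).2.1]

theorem IsIdentity.diconj_lp (h : T.IsIdentity one) {y a : A}
    (hay : T.sharp (T.lp one a) (T.lp one y) = one) (u v : A) :
    T.diconj y a (T.lp u v) = T.lp (T.diconj y a u) (T.diconj y a v) := by
  rw [h.lp_eq u, h.diconj_sharp hay, h.lp_eq (T.diconj y a u), h.lp_one_diconj]

theorem IsIdentity.diconj_rp (h : T.IsIdentity one) {y a : A}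
    (hay : T.sharp (T.lp one a) (T.lp one y) = one) (u v : A) :
    T.diconj y a (T.rp u v) = T.rp (T.diconj y a u) (T.diconj y a v) := by
  rw [h.rp_eq u, h.diconj_sharp hay, h.rp_eq (T.diconj y a u), h.lp_one_diconj]

theorem IsIdentity.isBarUnit_diconj (h : T.IsIdentity one) {y a e : A}
    (hya : T.sharp (T.lp one y) (T.lp one a) = one) (he : T.IsBarUnit e) :
    T.IsBarUnit (T.diconj y a e) := by
  rw [h.isBarUnit_iff] at he ⊢
  rw [h.lp_one_diconj, he, h.diconj_eq, (h _).2.1, hya]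

theorem IsIdentity.lp_one_sharp_lp_one_eq_one (h : T.IsIdentity one) {a y e : A}
    (he : T.IsBarUnit e) (hy : T.lp y a = e) :
    T.sharp (T.lp one y) (T.lp one a) = one := by
  rw [← h.lp_eq, T.lp_assoc, hy, (he one).2]

/-- A left inverse and a right inverse of `a` have the same image under `x ↦ 1 ⇀ x`. -/
theorem IsIdentity.lp_one_sharp_lp_one_eq_one_of_rp (h : T.IsIdentity one) {a y z e : A}
    (he : T.IsBarUnit e) (hy : T.lp y a = e) (hz : T.rp a z = e) :
    T.sharp (T.lp one a) (T.lp one y) = one := by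
  have hya := h.lp_one_sharp_lp_one_eq_one he hy
  have haz : T.sharp (T.lp one a) (T.lp one z) = one := by
    rw [← h.lp_one_lp_one a, ← h.lp_one_sharp, ← h.rp_eq, hz, (he one).2]
  have hyz : T.lp one y = T.lp one z := by
    calc T.lp one y = T.sharp (T.lp one y) (T.sharp (T.lp one a) (T.lp one z)) := by
          rw [haz, (h _).1]
      _ = T.lp one z := by rw [← T.sharp_assoc, hya, (h _).2.1]
  rw [hyz, haz]

end SevenTuple

/-- The diconjugation `Ψ_a` intertwines the left addition, right addition and
Hu-Liu product induced by a bar-unit `e` with those induced by `Ψ_a(e)`,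
which is again a bar-unit. -/
theorem diconjugation_preserves_induced_ops (T : SevenTuple A) (one : A)
    (hone : T.IsIdentity one) (a y z e₀ : A) (he₀ : T.IsBarUnit e₀)
    (hy : T.lp y a = e₀) (hz : T.rp a z = e₀) :
    ∀ e ∈ T.halo,
      (T.lp (T.rp y e) a ∈ T.halo) ∧
      ∀ x₁ x₂ : A,
        T.lp (T.rp y (x₁ + T.lp e x₂)) a
          = T.lp (T.rp y x₁) a + T.lp (T.lp (T.rp y e) a) (T.lp (T.rp y x₂) a) ∧
        T.lp (T.rp y (T.rp x₁ e + x₂)) a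
          = T.rp (T.lp (T.rp y x₁) a) (T.lp (T.rp y e) a) + T.lp (T.rp y x₂) a ∧
        T.lp (T.rp y (T.bullet e x₁ x₂)) a
          = T.bullet (T.lp (T.rp y e) a) (T.lp (T.rp y x₁) a) (T.lp (T.rp y x₂) a) := by
  intro e he
  have hya := hone.lp_one_sharp_lp_one_eq_one he₀ hy
  have hay := hone.lp_one_sharp_lp_one_eq_one_of_rp he₀ hy hz
  refine ⟨hone.isBarUnit_diconj hya he, fun x₁ x₂ => ?_⟩
  change T.diconj y a _ = T.diconj y a _ + T.lp (T.diconj y a _) (T.diconj y a _) ∧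
    T.diconj y a _ = T.rp (T.diconj y a _) (T.diconj y a _) + T.diconj y a _ ∧
    T.diconj y a _ = T.bullet (T.diconj y a _) (T.diconj y a _) (T.diconj y a _)
  simp only [SevenTuple.bullet, SevenTuple.diconj_add, SevenTuple.diconj_sub,
    hone.diconj_lp hay, hone.diconj_rp hay, and_self]
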